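/- arXiv:2510.10500 — 2 statements merged into one kernel-verified Lean document; each statement's English description precedes it below -/
import Mathlib

section
/- Let G be a connected graph of even order n ≥ max{6δ−4, (δ²+7δ+4)/6} with minimum degree δ ≥ 2. If e(G) ≥ e(K_δ ∨ (K_{n-2δ+1} ∪ (δ-1)K_1)), then G contains an even factor, unless G is isomorphic to K_δ ∨ (K_{n-2δ+1} ∪ (δ-1)K_1). -/
/-- A graph `G` has an even factor if there is a spanning subgraph `F` of `G`
all of whose degrees are even and positive. -/
def HasEvenFactor {V : Type*} [Fintype V] (G : SimpleGraph V) : Prop :=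
  ∃ F : SimpleGraph V, F ≤ G ∧
    ∀ v : V, Even (Nat.card (F.neighborSet v)) ∧ 0 < Nat.card (F.neighborSet v)

/-- The graph `K_s ∨ (K_a ∪ t·K_p)`. -/
def joinGraph (s a t p : ℕ) : SimpleGraph (Fin (s + a + t * p)) :=
  SimpleGraph.fromRel (fun u v =>
    (u : ℕ) < s ∨ (v : ℕ) < s ∨
    ((u : ℕ) < s + a ∧ (v : ℕ) < s + a) ∨
    (s + a ≤ (u : ℕ) ∧ s + a ≤ (v : ℕ) ∧
      ((u : ℕ) - (s + a)) / p = ((v : ℕ) - (s + a)) / p))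

/-- The number of edges of a graph on a finite vertex type. -/
noncomputable def edgeCount {V : Type*} [Fintype V] (G : SimpleGraph V) : ℕ :=
  G.edgeSet.toFinite.toFinset.card

theorem two_mul_edgeCount {V : Type*} [Fintype V] (G : SimpleGraph V) [DecidableRel G.Adj] :
    2 * edgeCount G = ∑ v, G.degree v := by
  rw [G.sum_degrees_eq_twice_card_edges, edgeCount]
  congr 2
  ext e
  simp

theorem joinGraph_one_degree_sum_le (s a t : ℕ) :
    s * (s + a + t - 1) + a * (s + a - 1) + t * s ≤ 2 * edgeCount (joinGraph s a t 1) := by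
  classical
  rw [two_mul_edgeCount, Fin.sum_univ_add, Fin.sum_univ_add]
  have card_lt (k : ℕ) (hk : k ≤ s + a + t * 1) :
      (Finset.univ.filter fun v : Fin (s + a + t * 1) => (v : ℕ) < k).card = k := by
    rw [Fin.card_filter_val_lt]
    omega
  have h₁ (u : Fin s) : s + a + t - 1 ≤
      (joinGraph s a t 1).degree (Fin.castAdd (t * 1) (Fin.castAdd a u)) := by
    calc s + a + t - 1 = (Finset.univ.erase (Fin.castAdd (t * 1) (Fin.castAdd a u))).card := by
          simp
      _ ≤ _ := by
          refine Finset.card_le_card fun v hv => ?_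
          simp only [Finset.mem_erase, Finset.mem_univ, and_true] at hv
          rw [SimpleGraph.mem_neighborFinset]
          simp [joinGraph, SimpleGraph.fromRel_adj, hv.symm]
  have h₂ (u : Fin a) : s + a - 1 ≤
      (joinGraph s a t 1).degree (Fin.castAdd (t * 1) (Fin.natAdd s u)) := by
    calc s + a - 1 = ((Finset.univ.filter fun v : Fin (s + a + t * 1) => (v : ℕ) < s + a).erase
            (Fin.castAdd (t * 1) (Fin.natAdd s u))).card := by
          rw [Finset.card_erase_of_mem (by simp), card_lt _ (by omega)]
      _ ≤ _ := by
          refine Finset.card_le_card fun v hv => ?_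
          simp only [Finset.mem_erase, Finset.mem_filter, Finset.mem_univ, true_and] at hv
          rw [SimpleGraph.mem_neighborFinset]
          simp [joinGraph, SimpleGraph.fromRel_adj, hv.1.symm, hv.2]
  have h₃ (u : Fin (t * 1)) : s ≤ (joinGraph s a t 1).degree (Fin.natAdd (s + a) u) := by
    calc s = (Finset.univ.filter fun v : Fin (s + a + t * 1) => (v : ℕ) < s).card :=
          (card_lt _ (by omega)).symm
      _ ≤ _ := by
          refine Finset.card_le_card fun v hv => ?_
          simp only [Finset.mem_filter, Finset.mem_univ, true_and] at hv
          have : Fin.natAdd (s + a) u ≠ v := by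
            rintro rfl
            simp only [Fin.val_natAdd] at hv
            omega
          rw [SimpleGraph.mem_neighborFinset]
          simp [joinGraph, SimpleGraph.fromRel_adj, this, hv]
  have e₁ := Finset.sum_le_sum fun u (_ : u ∈ Finset.univ) => h₁ u
  have e₂ := Finset.sum_le_sum fun u (_ : u ∈ Finset.univ) => h₂ u
  have e₃ := Finset.sum_le_sum fun u (_ : u ∈ Finset.univ) => h₃ u
  simp only [Finset.sum_const, Finset.card_univ, Fintype.card_fin, smul_eq_mul, mul_one] at e₁ e₂ e₃
  omega

namespace SimpleGraph

variable {V : Type*}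

theorem neighborSet_symmDiff (F C : SimpleGraph V) (u : V) :
    (symmDiff F C).neighborSet u = symmDiff (F.neighborSet u) (C.neighborSet u) := by
  ext x
  simp [symmDiff_def, Set.mem_union]

/-- Every vertex has even degree. -/
def AllDegreesEven (F : SimpleGraph V) : Prop :=
  ∀ v, Even (F.neighborSet v).ncard

theorem even_ncard_symmDiff {α : Type*} [Finite α] {A B : Set α}
    (hA : Even A.ncard) (hB : Even B.ncard) : Even (symmDiff A B).ncard := by
  have h : (symmDiff A B).ncard = (A \ B).ncard + (B \ A).ncard :=
    Set.ncard_union_eq (Set.disjoint_left.2 fun x hx hy => hy.2 hx.1)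
  have h₁ := Set.ncard_inter_add_ncard_sdiff_eq_ncard A B
  have h₂ := Set.ncard_inter_add_ncard_sdiff_eq_ncard B A
  rw [Set.inter_comm] at h₂
  rw [h]
  grind

theorem AllDegreesEven.symmDiff [Finite V] {F C : SimpleGraph V}
    (hF : F.AllDegreesEven) (hC : C.AllDegreesEven) : (symmDiff F C).AllDegreesEven := by
  intro u
  rw [neighborSet_symmDiff]
  exact even_ncard_symmDiff (hF u) (hC u)

/-- There is an even subgraph of `G` such that any even subgraph through one of its isolated
vertices agrees with it around some non-isolated vertex. -/
theorem exists_allDegreesEven_maximal [Finite V] (G : SimpleGraph V) :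
    ∃ F ≤ G, F.AllDegreesEven ∧ ∀ v, F.neighborSet v = ∅ →
      ∀ C ≤ G, C.AllDegreesEven → (C.neighborSet v).Nonempty →
        ∃ u, (F.neighborSet u).Nonempty ∧ F.neighborSet u = C.neighborSet u := by
  obtain ⟨F, ⟨hFG, hF⟩, hmax⟩ :=
    Set.exists_max_image {F : SimpleGraph V | F ≤ G ∧ F.AllDegreesEven}
      (fun F => {u | (F.neighborSet u).Nonempty}.ncard) (Set.toFinite _)
      ⟨⊥, bot_le, fun v => by simp [neighborSet]⟩
  refine ⟨F, hFG, hF, fun v hv C hCG hC hCv => ?_⟩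
  by_contra! hne
  refine absurd (hmax (_root_.symmDiff F C) ⟨symmDiff_le_sup.trans (sup_le hFG hCG), hF.symmDiff hC⟩)
    (not_le.2 (Set.ncard_lt_ncard (Set.ssubset_iff_of_subset ?_ |>.2 ⟨v, ?_, ?_⟩) (Set.toFinite _)))
  · intro u hu
    rw [Set.mem_ofPred_eq, neighborSet_symmDiff, Set.nonempty_iff_ne_empty]
    exact fun h => hne u hu (symmDiff_eq_bot.1 h)
  · rw [Set.mem_ofPred_eq, neighborSet_symmDiff, hv]
    simpa [symmDiff_def] using hCv
  · rw [Set.mem_ofPred_eq, hv]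
    exact Set.not_nonempty_empty

/-- The triangle on the vertices `v`, `x`, `y`. -/
def triangle (v x y : V) : SimpleGraph V where
  Adj a b := a ≠ b ∧ a ∈ ({v, x, y} : Set V) ∧ b ∈ ({v, x, y} : Set V)
  symm := ⟨fun _ _ h => ⟨h.1.symm, h.2.2, h.2.1⟩⟩
  loopless := ⟨fun _ h => h.1 rfl⟩

theorem allDegreesEven_triangle [Finite V] {v x y : V} (hvx : v ≠ x) (hvy : v ≠ y) (hxy : x ≠ y) :
    (triangle v x y).AllDegreesEven := by
  intro a
  have key : ∀ {p q : V}, p ≠ q → (∀ b, (triangle v x y).Adj a b ↔ b = p ∨ b = q) →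
      Even ((triangle v x y).neighborSet a).ncard := by
    intro p q hpq h
    have : (triangle v x y).neighborSet a = {p, q} := by ext b; simp [h b]
    rw [this, Set.ncard_pair hpq]
    exact even_two
  by_cases hv : a = v
  · exact key hxy fun b => by simp only [triangle, Set.mem_insert_iff, Set.mem_singleton_iff]; grind
  by_cases hx : a = x
  · exact key hvy fun b => by simp only [triangle, Set.mem_insert_iff, Set.mem_singleton_iff]; grind
  by_cases hy : a = y
  · exact key hvx fun b => by simp only [triangle, Set.mem_insert_iff, Set.mem_singleton_iff]; grind
  have : (triangle v x y).neighborSet a = ∅ := by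
    ext b
    simp [triangle, hv, hx, hy]
  simp [this]

/-- The four-cycle `v x w y`. -/
def fourCycle (v x w y : V) (hvx : v ≠ x) (hvy : v ≠ y) (hwx : w ≠ x) (hwy : w ≠ y) :
    SimpleGraph V where
  Adj a b := ((a = v ∨ a = w) ∧ (b = x ∨ b = y)) ∨ ((a = x ∨ a = y) ∧ (b = v ∨ b = w))
  symm := ⟨fun _ _ h => by tauto⟩
  loopless := ⟨fun a h => by grind⟩

theorem allDegreesEven_fourCycle [Finite V] {v x w y : V} (hvx : v ≠ x) (hvy : v ≠ y)
    (hwx : w ≠ x) (hwy : w ≠ y) (hvw : v ≠ w) (hxy : x ≠ y) :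
    (fourCycle v x w y hvx hvy hwx hwy).AllDegreesEven := by
  intro a
  by_cases h₁ : a = v ∨ a = w
  · have : (fourCycle v x w y hvx hvy hwx hwy).neighborSet a = {x, y} := by
      ext b
      simp only [fourCycle, mem_neighborSet, Set.mem_insert_iff, Set.mem_singleton_iff]
      grind
    rw [this, Set.ncard_pair hxy]
    exact even_two
  by_cases h₂ : a = x ∨ a = y
  · have : (fourCycle v x w y hvx hvy hwx hwy).neighborSet a = {v, w} := by
      ext b
      simp only [fourCycle, mem_neighborSet, Set.mem_insert_iff, Set.mem_singleton_iff]
      grind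
    rw [this, Set.ncard_pair hvw]
    exact even_two
  have : (fourCycle v x w y hvx hvy hwx hwy).neighborSet a = ∅ := by
    ext b
    simp only [fourCycle, mem_neighborSet, Set.mem_empty_iff_false]
    tauto
  simp [this]

/-- A graph with no spanning even subgraph of positive degrees has a vertex whose neighbours are
pairwise non-adjacent and such that every other vertex is adjacent to at most two of them. -/
theorem exists_sparse_neighborhood [Fintype V] (G : SimpleGraph V) (h : ¬ HasEvenFactor G) :
    ∃ v, (∀ x y, G.Adj v x → G.Adj v y → ¬ G.Adj x y) ∧
      ∀ w, w ≠ v → ∀ x y z, G.Adj v x → G.Adj v y → G.Adj v z →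
        G.Adj w x → G.Adj w y → G.Adj w z → x ≠ y → y ≠ z → x = z := by
  obtain ⟨F, hFG, hF, hmax⟩ := G.exists_allDegreesEven_maximal
  obtain ⟨v, hv⟩ : ∃ v, F.neighborSet v = ∅ := by
    by_contra! hne
    refine h ⟨F, hFG, fun v => ⟨hF v, ?_⟩⟩
    exact (Set.ncard_pos (Set.toFinite _)).2 (hne v)
  have hvF (u : V) : ¬ F.Adj u v := fun hu => by
    have : u ∈ F.neighborSet v := hu.symm
    simp [hv] at this
  have hsquare (w x y : V) (hwv : w ≠ v) (hvx : G.Adj v x) (hvy : G.Adj v y) (hwx : G.Adj w x)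
      (hwy : G.Adj w y) (hxy : x ≠ y) (b : V) : F.Adj w b ↔ b = x ∨ b = y := by
    obtain ⟨u, ⟨c, hc⟩, hu⟩ := hmax v hv
      (fourCycle v x w y hvx.ne hvy.ne hwx.ne hwy.ne)
      (by
        intro a b hab
        have := hvx.symm
        have := hvy.symm
        have := hwx.symm
        have := hwy.symm
        rcases hab with ⟨rfl | rfl, rfl | rfl⟩ | ⟨rfl | rfl, rfl | rfl⟩ <;> assumption)
      (allDegreesEven_fourCycle _ _ _ _ hwv.symm hxy) ⟨x, by simp [fourCycle]⟩
    have hadj (b : V) : F.Adj u b ↔ (fourCycle v x w y hvx.ne hvy.ne hwx.ne hwy.ne).Adj u b :=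
      Set.ext_iff.1 hu b
    have hc' := (hadj c).1 hc
    have h₁ := mt (hadj v).2 (hvF u)
    have huw : u = w := by
      have : u ≠ v := by
        rintro rfl
        exact hvF c hc.symm
      simp only [fourCycle] at h₁ hc'
      tauto
    subst huw
    rw [hadj]
    simp [fourCycle, hwx.ne, hwy.ne]
  refine ⟨v, fun x y hvx hvy hxy => ?_, fun w hwv x y z hx hy hz hwx hwy hwz hxy hyz => ?_⟩
  · obtain ⟨u, ⟨c, hc⟩, hu⟩ := hmax v hv (triangle v x y)
      (by
        rintro a b ⟨hab, ha, hb⟩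
        have := hvx.symm
        have := hvy.symm
        have := hxy.symm
        rcases ha with rfl | rfl | rfl <;> rcases hb with rfl | rfl | rfl <;>
          first | assumption | exact absurd rfl hab)
      (allDegreesEven_triangle hvx.ne hvy.ne hxy.ne) ⟨x, by simp [triangle, hvx.ne]⟩
    have hadj (b : V) : F.Adj u b ↔ (triangle v x y).Adj u b := Set.ext_iff.1 hu b
    refine hvF u ((hadj v).2 ⟨?_, ((hadj c).1 hc).2.1, by simp⟩)
    rintro rfl
    exact hvF c hc.symm
  · have h₁ := (hsquare w x y hwv hx hy hwx hwy hxy x).2 (.inl rfl)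
    have h₂ := (hsquare w y z hwv hy hz hwy hwz hyz x).1 h₁
    tauto

/-- The degree sum of a graph having a vertex with a sparse neighbourhood. -/
theorem sum_degree_le_of_sparse_neighborhood [Fintype V] (G : SimpleGraph V)
    [DecidableRel G.Adj] {v : V} (hind : ∀ x y, G.Adj v x → G.Adj v y → ¬ G.Adj x y)
    (htwo : ∀ w, w ≠ v → ∀ x y z, G.Adj v x → G.Adj v y → G.Adj v z →
        G.Adj w x → G.Adj w y → G.Adj w z → x ≠ y → y ≠ z → x = z) {m : ℕ}
    (hm : G.degree v + m + 1 = Fintype.card V) :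
    ∑ u, G.degree u ≤ 2 * G.degree v + m * (m + 3) := by
  classical
  set D := G.neighborFinset v with hD
  set W := (insert v D)ᶜ with hW
  have hvD : v ∉ D := by simp [hD]
  have hDcard : D.card = G.degree v := rfl
  have hWcard : W.card = m := by
    rw [hW, Finset.card_compl, Finset.card_insert_of_notMem hvD]
    omega
  have hsplit (f : V → ℕ) : ∑ u, f u = f v + ∑ u ∈ D, f u + ∑ u ∈ W, f u := by
    rw [← Finset.sum_insert hvD, hW, Finset.sum_add_sum_compl]
  have hWD : ∀ w ∈ W, (D.filter (G.Adj w)).card ≤ 2 := by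
    intro w hw
    have hwv : w ≠ v := by
      rintro rfl
      simp [hW] at hw
    by_contra! hlt
    obtain ⟨x, y, z, hx, hy, hz, hxy, hxz, hyz⟩ := Finset.two_lt_card_iff.1 hlt
    simp only [hD, Finset.mem_filter, mem_neighborFinset] at hx hy hz
    exact hxz (htwo w hwv x y z hx.1 hy.1 hz.1 hx.2 hy.2 hz.2 hxy hyz)
  have hDsum : ∑ x ∈ D, G.degree x ≤ G.degree v + m * 2 := by
    have hdc : ∑ x ∈ D, G.degree x = ∑ u, (D.filter (G.Adj u)).card := by
      have := Finset.sum_card_bipartiteAbove_eq_sum_card_bipartiteBelow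
        (s := D) (t := Finset.univ) G.Adj
      simp only [Finset.bipartiteAbove, Finset.bipartiteBelow] at this
      calc ∑ x ∈ D, G.degree x = ∑ x ∈ D, (Finset.univ.filter (G.Adj x)).card := by
            refine Finset.sum_congr rfl fun x _ => ?_
            rw [← card_neighborFinset_eq_degree, neighborFinset_eq_filter]
        _ = _ := by simpa only [G.adj_comm] using this
    rw [hdc, hsplit]
    have h₁ : (D.filter (G.Adj v)).card ≤ G.degree v := Finset.card_filter_le _ _
    have h₂ : ∑ u ∈ D, (D.filter (G.Adj u)).card = 0 := by
      refine Finset.sum_eq_zero fun u hu => ?_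
      rw [Finset.card_eq_zero, Finset.filter_eq_empty_iff]
      intro x hx
      exact hind u x (by simpa [hD] using hu) (by simpa [hD] using hx)
    have h₃ := Finset.sum_le_card_nsmul W _ 2 hWD
    rw [hWcard, smul_eq_mul] at h₃
    omega
  have hWsum : ∑ w ∈ W, G.degree w ≤ m * (m + 1) := by
    have : ∀ w ∈ W, G.degree w ≤ m + 1 := by
      intro w hw
      have hsub : G.neighborFinset w ⊆ W.erase w ∪ D.filter (G.Adj w) := by
        intro b hb
        rw [mem_neighborFinset] at hb
        have hbv : b ≠ v := by
          rintro rfl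
          simp [hW, hD, hb.symm] at hw
        by_cases hbD : b ∈ D
        · simp [hbD, hb]
        · simp [hW, hbD, hbv, hb.ne']
      have h₁ := (Finset.card_le_card hsub).trans (Finset.card_union_le _ _)
      have h₂ := Finset.card_erase_add_one hw
      have h₃ := hWD w hw
      rw [card_neighborFinset_eq_degree] at h₁
      omega
    have := Finset.sum_le_card_nsmul W _ _ this
    rwa [hWcard, smul_eq_mul] at this
  rw [hsplit]
  nlinarith

end SimpleGraph

theorem even_factor_of_size {V : Type*} [Fintype V] [DecidableEq V]
    (G : SimpleGraph V) [DecidableRel G.Adj] (n δ : ℕ)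
    (hcard : Fintype.card V = n) (hconn : G.Connected) (heven : Even n)
    (hδ : G.minDegree = δ) (hδ2 : 2 ≤ δ)
    (hn1 : 6 * δ - 4 ≤ n) (hn2 : ((δ : ℝ) ^ 2 + 7 * δ + 4) / 6 ≤ (n : ℝ))
    (hsize : edgeCount (joinGraph δ (n - 2 * δ + 1) (δ - 1) 1) ≤ edgeCount G) :
    HasEvenFactor G ∨ Nonempty (G ≃g joinGraph δ (n - 2 * δ + 1) (δ - 1) 1) := by
  left
  by_contra h
  obtain ⟨v, hind, htwo⟩ := G.exists_sparse_neighborhood h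
  have hδd : δ ≤ G.degree v := hδ ▸ G.minDegree_le_degree v
  obtain ⟨m, hm⟩ := Nat.exists_eq_add_of_le (Nat.succ_le_of_lt (G.degree_lt_card_verts v))
  have hupper := G.sum_degree_le_of_sparse_neighborhood hind htwo (m := m) (by omega)
  have hlower := joinGraph_one_degree_sum_le δ (n - 2 * δ + 1) (δ - 1)
  rw [← two_mul_edgeCount] at hupper
  obtain ⟨k, rfl⟩ := Nat.exists_eq_add_of_le hδ2
  obtain ⟨l, hl⟩ := Nat.exists_eq_add_of_le hδd
  obtain ⟨a, rfl⟩ := Nat.exists_eq_add_of_le (show 2 * (2 + k) ≤ n by omega)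
  rw [show 2 * (2 + k) + a - 2 * (2 + k) + 1 = a + 1 by omega,
    show 2 + k - 1 = k + 1 by omega] at hsize hlower
  rw [show 2 + k + (a + 1) + (k + 1) - 1 = 2 * k + a + 3 by omega,
    show 2 + k + (a + 1) - 1 = a + k + 2 by omega] at hlower
  rw [hl] at hupper
  have ha : a + k + 1 = l + m := by omega
  have hle : (2 + k) * (2 * k + a + 3) + (a + 1) * (a + k + 2) + (k + 1) * (2 + k) ≤
      2 * (2 + k + l) + m * (m + 3) := by omega
  zify at hle ha
  have ha' : (a : ℤ) = l + m - k - 1 := by linarith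
  rw [ha'] at hle
  nlinarith [mul_nonneg (Int.natCast_nonneg l) (Int.natCast_nonneg m),
    mul_nonneg (Int.natCast_nonneg l) (Int.natCast_nonneg l)]
end

section
/- Let G be a connected graph of even order n ≥ max{5δ−3, δ²/3 + δ} with minimum degree δ ≥ 2. If ρ(G) ≥ ρ(K_δ ∨ (K_{n-2δ+1} ∪ (δ-1)K_1)), then G contains an even factor, unless G is isomorphic to K_δ ∨ (K_{n-2δ+1} ∪ (δ-1)K_1). -/
/-- The adjacency spectral radius of a graph. -/
noncomputable def specRad {V : Type*} [Fintype V] [DecidableEq V]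
    (G : SimpleGraph V) : ℝ :=
  letI : DecidableRel G.Adj := Classical.decRel _
  sSup (spectrum ℝ (G.adjMatrix ℝ))

namespace SimpleGraph

open Finset
open scoped Matrix

section SpectralRadius

variable {V : Type*} [Fintype V] [DecidableEq V] (G : SimpleGraph V) [DecidableRel G.Adj]

lemma specRad_eq_sSup : specRad G = sSup (spectrum ℝ (G.adjMatrix ℝ)) := by
  unfold specRad
  congr!

lemma finite_spectrum_adjMatrix : (spectrum ℝ (G.adjMatrix ℝ)).Finite := by
  rw [(G.isHermitian_adjMatrix (R := ℝ)).spectrum_real_eq_range_eigenvalues]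
  exact Set.finite_range _

lemma exists_adjMatrix_eigenvector [Nonempty V] :
    ∃ y : V → ℝ, y ≠ 0 ∧ G.adjMatrix ℝ *ᵥ y = specRad G • y := by
  have hne : (spectrum ℝ (G.adjMatrix ℝ)).Nonempty := by
    rw [(G.isHermitian_adjMatrix (R := ℝ)).spectrum_real_eq_range_eigenvalues]
    exact Set.range_nonempty _
  have hmem := hne.csSup_mem G.finite_spectrum_adjMatrix
  rw [← specRad_eq_sSup, ← Matrix.spectrum_toLin', ← Module.End.hasEigenvalue_iff_mem_spectrum]
    at hmem
  obtain ⟨y, hy⟩ := hmem.exists_hasEigenvector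
  exact ⟨y, hy.2, by simpa using hy.apply_eq_smul⟩

lemma dotProduct_adjMatrix_mulVec_le (x : V → ℝ) :
    x ⬝ᵥ (G.adjMatrix ℝ *ᵥ x) ≤ specRad G * (x ⬝ᵥ x) := by
  have hpsd : (algebraMap ℝ (Matrix V V ℝ) (specRad G) - G.adjMatrix ℝ).PosSemidef := by
    rw [Matrix.posSemidef_iff_isHermitian_and_spectrum_nonneg]
    refine ⟨Matrix.IsHermitian.sub ?_ (G.isHermitian_adjMatrix (R := ℝ)), ?_⟩
    · simp [Matrix.IsHermitian, Matrix.algebraMap_eq_diagonal]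
    · rw [← spectrum.singleton_sub_eq]
      rintro _ ⟨a, rfl, b, hb, rfl⟩
      have := le_csSup G.finite_spectrum_adjMatrix.bddAbove hb
      rw [← specRad_eq_sSup] at this
      simpa using this
  have h := hpsd.dotProduct_mulVec_nonneg x
  simp only [star_trivial, Matrix.sub_mulVec, dotProduct_sub,
    Algebra.algebraMap_eq_smul_one, Matrix.smul_mulVec, Matrix.one_mulVec, dotProduct_smul,
    smul_eq_mul] at h
  linarith

lemma IsClique.card_sub_one_le_specRad {K : Finset V} (hK : G.IsClique K) (hne : K.Nonempty) :
    (#K : ℝ) - 1 ≤ specRad G := by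
  have h := G.dotProduct_adjMatrix_mulVec_le fun v => if v ∈ K then 1 else 0
  have h1 : ∀ v ∈ K, (G.adjMatrix ℝ *ᵥ fun v => if v ∈ K then 1 else 0) v = #K - 1 := by
    intro v hv
    have : (G.neighborFinset v).filter (· ∈ K) = K.erase v := by
      ext w
      simp only [mem_filter, mem_neighborFinset, mem_erase]
      exact ⟨fun ⟨a, b⟩ => ⟨a.ne', b⟩, fun ⟨a, b⟩ => ⟨hK hv b a.symm, b⟩⟩
    rw [adjMatrix_mulVec_apply, sum_boole, this, card_erase_of_mem hv,
      Nat.cast_sub (card_pos.2 hne), Nat.cast_one]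
  have h2 : (∑ v ∈ K, (G.adjMatrix ℝ *ᵥ fun v => if v ∈ K then 1 else 0) v)
      = #K * ((#K : ℝ) - 1) := by
    rw [sum_congr rfl h1, sum_const, nsmul_eq_mul]
  simp only [dotProduct, ite_mul, one_mul, zero_mul, sum_ite_mem, univ_inter, h2, sum_const,
    inter_self, nsmul_eq_mul, mul_one] at h
  have hpos : (0 : ℝ) < #K := by exact_mod_cast card_pos.2 hne
  nlinarith

variable {G}

lemma sum_neighborFinset_degree_le {δ : ℕ} (hδ : ∀ v, δ ≤ G.degree v) (u : V) :
    (∑ v ∈ G.neighborFinset u, (G.degree v : ℝ)) ≤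
      ∑ v, (G.degree v : ℝ) - (Fintype.card V - 1) * δ + (δ - 1) * G.degree u := by
  have hu : u ∉ G.neighborFinset u := by simp
  have hsplit := sum_add_sum_compl (insert u (G.neighborFinset u)) fun v => (G.degree v : ℝ)
  rw [sum_insert hu] at hsplit
  have hcard : (#(insert u (G.neighborFinset u))ᶜ : ℝ) = Fintype.card V - (G.degree u + 1) := by
    rw [card_compl, Nat.cast_sub (card_le_univ _), card_insert_of_notMem hu,
      card_neighborFinset_eq_degree]
    push_cast
    ring
  have hrest := card_nsmul_le_sum (insert u (G.neighborFinset u))ᶜ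
    (fun v => (G.degree v : ℝ)) δ fun v _ => by exact_mod_cast hδ v
  rw [nsmul_eq_mul, hcard] at hrest
  linarith

lemma specRad_mul_sub_le [Nonempty V] {δ : ℕ} (hδ : ∀ v, δ ≤ G.degree v)
    (hρ : (δ : ℝ) - 1 ≤ specRad G) :
    specRad G * (specRad G - (δ - 1)) ≤
      ∑ v, (G.degree v : ℝ) - (Fintype.card V - 1) * δ := by
  obtain ⟨y, hy0, hy⟩ := G.exists_adjMatrix_eigenvector
  set ρ := specRad G
  have hswap : ∀ f g : V → ℝ, ∑ v, f v * ∑ u ∈ G.neighborFinset v, g u =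
      ∑ u, (∑ v ∈ G.neighborFinset u, f v) * g u := by
    intro f g
    simp_rw [mul_sum, sum_mul]
    exact sum_comm' (by simp [G.adj_comm])
  have hle : ∀ v, ρ * |y v| ≤ ∑ u ∈ G.neighborFinset v, |y u| := by
    intro v
    have h : ∑ u ∈ G.neighborFinset v, y u = ρ * y v := by
      simpa [adjMatrix_mulVec_apply] using congrFun hy v
    calc ρ * |y v| ≤ |ρ| * |y v| := by gcongr; exact le_abs_self ρ
      _ = |∑ u ∈ G.neighborFinset v, y u| := by rw [h, abs_mul]
      _ ≤ _ := abs_sum_le_sum_abs _ _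
  have hS : 0 < ∑ v, |y v| := by
    obtain ⟨v, hv⟩ := Function.ne_iff.1 hy0
    exact sum_pos' (fun _ _ => abs_nonneg _) ⟨v, mem_univ v, abs_pos.2 hv⟩
  have hP : ρ * ∑ v, |y v| ≤ ∑ v, (G.degree v : ℝ) * |y v| := by
    rw [mul_sum]
    refine (sum_le_sum fun v _ => hle v).trans_eq ?_
    simpa using hswap (fun _ => 1) fun v => |y v|
  have hQ : ρ * ∑ v, (G.degree v : ℝ) * |y v| ≤
      (∑ v, (G.degree v : ℝ) - (Fintype.card V - 1) * δ) * ∑ v, |y v| +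
        (δ - 1) * ∑ v, (G.degree v : ℝ) * |y v| := by
    calc ρ * ∑ v, (G.degree v : ℝ) * |y v|
        = ∑ v, (G.degree v : ℝ) * (ρ * |y v|) := by
          rw [mul_sum]
          exact sum_congr rfl fun _ _ => by ring
      _ ≤ ∑ v, (G.degree v : ℝ) * ∑ u ∈ G.neighborFinset v, |y u| :=
          sum_le_sum fun v _ => by gcongr; exact hle v
      _ = ∑ u, (∑ v ∈ G.neighborFinset u, (G.degree v : ℝ)) * |y u| := hswap _ _
      _ ≤ ∑ u, (∑ v, (G.degree v : ℝ) - (Fintype.card V - 1) * δ +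
            (δ - 1) * G.degree u) * |y u| :=
          sum_le_sum fun u _ => by gcongr; exact sum_neighborFinset_degree_le hδ u
      _ = _ := by
          rw [mul_sum univ (fun v => |y v|), mul_sum univ (fun v => (G.degree v : ℝ) * |y v|),
            ← sum_add_distrib]
          exact sum_congr rfl fun _ _ => by ring
  have := mul_le_mul_of_nonneg_left hP (sub_nonneg.2 hρ)
  refine le_of_mul_le_mul_right ?_ hS
  linarith

end SpectralRadius

section EvenSubgraph

open scoped Classical symmDiff

lemma card_symmDiff_pair {V : Type*} (s : Finset V) {a b : V} (hab : a ≠ b) :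
    #(s ∆ {a, b}) + 2 * #(s ∩ {a, b}) = #s + 2 := by
  have h1 := card_inter_add_card_sdiff s {a, b}
  have h2 := card_inter_add_card_sdiff {a, b} s
  have h3 : #(s ∆ {a, b}) = #(s \ {a, b}) + #({a, b} \ s) :=
    card_union_of_disjoint disjoint_sdiff_sdiff
  rw [inter_comm, card_pair hab] at h2
  omega

variable {V : Type*} [Fintype V]

lemma neighborFinset_symmDiff (F C : SimpleGraph V) (y : V) :
    (F ∆ C).neighborFinset y = F.neighborFinset y ∆ C.neighborFinset y := by
  ext z
  simp only [mem_neighborFinset, mem_symmDiff]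
  simp [symmDiff_def]

/-- All degrees of the graph are even. -/
def AllEven (F : SimpleGraph V) : Prop := ∀ v, Even (F.degree v)

/-- The sum of all degrees plus the number of vertices of positive degree. -/
noncomputable def coverWeight (F : SimpleGraph V) : ℕ :=
  ∑ v, (F.degree v + if F.degree v = 0 then 0 else 1)

/-- `F` is an even subgraph of `G` maximising `coverWeight`. -/
def IsMaxEven (G F : SimpleGraph V) : Prop :=
  F ≤ G ∧ F.AllEven ∧ ∀ F' ≤ G, F'.AllEven → F'.coverWeight ≤ F.coverWeight

lemma exists_isMaxEven (G : SimpleGraph V) : ∃ F, G.IsMaxEven F := by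
  obtain ⟨F, hF, hmax⟩ := Set.exists_max_image {F : SimpleGraph V | F ≤ G ∧ F.AllEven}
    coverWeight (Set.toFinite _) ⟨⊥, bot_le, fun v => by simp⟩
  exact ⟨F, hF.1, hF.2, fun F' h h' => hmax F' ⟨h, h'⟩⟩

lemma degree_symmDiff_pair {F C : SimpleGraph V} {y a b : V} (hab : a ≠ b)
    (hC : C.neighborFinset y = {a, b}) :
    (F ∆ C).degree y + 2 * #(F.neighborFinset y ∩ {a, b}) = F.degree y + 2 := by
  rw [← card_neighborFinset_eq_degree, neighborFinset_symmDiff, hC, card_symmDiff_pair _ hab,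
    card_neighborFinset_eq_degree]

lemma degree_symmDiff_empty {F C : SimpleGraph V} {y : V} (hC : C.neighborFinset y = ∅) :
    (F ∆ C).degree y = F.degree y := by
  rw [← card_neighborFinset_eq_degree, neighborFinset_symmDiff, hC, ← bot_eq_empty,
    symmDiff_bot, card_neighborFinset_eq_degree]

lemma AllEven.symmDiff {F C : SimpleGraph V} (hF : F.AllEven)
    (hC : ∀ y, C.neighborFinset y = ∅ ∨ ∃ a b, a ≠ b ∧ C.neighborFinset y = {a, b}) :
    (F ∆ C).AllEven := by
  intro y
  have hy := hF y
  rcases hC y with h | ⟨a, b, hab, h⟩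
  · rwa [degree_symmDiff_empty h]
  · have := degree_symmDiff_pair (F := F) hab h
    grind

/-- Toggling a pair at `y`, at least one end of which is not `F`-adjacent to `y`, does not lower
the degree of `y`. -/
lemma degree_le_degree_symmDiff {F C : SimpleGraph V} {y a b : V} (hab : a ≠ b)
    (hC : C.neighborFinset y = {a, b}) (ha : ¬ F.Adj y a) :
    F.degree y ≤ (F ∆ C).degree y := by
  have h := degree_symmDiff_pair (F := F) hab hC
  have : #(F.neighborFinset y ∩ {a, b}) ≤ #{b} := by
    refine card_le_card fun z hz => ?_
    simp only [mem_inter, mem_neighborFinset, mem_insert, mem_singleton] at hz ⊢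
    grind
  rw [card_singleton] at this
  omega

lemma not_adj_of_degree_eq_zero {F : SimpleGraph V} {v : V} (h : F.degree v = 0) (u : V) :
    ¬ F.Adj v u := by
  intro hu
  have : u ∈ F.neighborFinset v := by simpa using hu
  rw [card_eq_zero.1 h] at this
  simp at this

lemma degree_symmDiff_of_degree_eq_zero {F C : SimpleGraph V} {y a b : V} (hab : a ≠ b)
    (hC : C.neighborFinset y = {a, b}) (h0 : F.degree y = 0) : (F ∆ C).degree y = 2 := by
  have h := degree_symmDiff_pair (F := F) hab hC
  rw [card_eq_zero.1 h0, h0] at h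
  simpa using h

lemma IsMaxEven.not_triangle {G F : SimpleGraph V} (hF : G.IsMaxEven F) {v u w : V}
    (hv : F.degree v = 0) (hvu : G.Adj v u) (hvw : G.Adj v w) : ¬ G.Adj u w := by
  intro huw
  obtain ⟨hFG, hev, hmax⟩ := hF
  obtain ⟨C, hCdef⟩ : ∃ C : SimpleGraph V, ∀ a b, C.Adj a b ↔
      s(a, b) ∈ ({s(v, u), s(v, w), s(u, w)} : Set (Sym2 V)) ∧ a ≠ b :=
    ⟨fromEdgeSet _, fun _ _ => fromEdgeSet_adj _⟩
  have n1 := hvu.ne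
  have n2 := hvw.ne
  have n3 := huw.ne
  have hCv : C.neighborFinset v = {u, w} := by ext z; simp [hCdef]; grind
  have hCu : C.neighborFinset u = {v, w} := by ext z; simp [hCdef]; grind
  have hCw : C.neighborFinset w = {v, u} := by ext z; simp [hCdef]; grind
  have hCo : ∀ y, y ≠ v → y ≠ u → y ≠ w → C.neighborFinset y = ∅ := by
    intro y h1 h2 h3
    ext z; simp [hCdef]; grind
  have hCG : C ≤ G := by
    intro a b hab
    simp [hCdef] at hab
    grind [G.adj_comm]
  have hev' : (F ∆ C).AllEven := hev.symmDiff fun y => by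
    by_cases h1 : y = v
    · exact .inr ⟨u, w, n3, h1 ▸ hCv⟩
    by_cases h2 : y = u
    · exact .inr ⟨v, w, n2, h2 ▸ hCu⟩
    by_cases h3 : y = w
    · exact .inr ⟨v, u, n1, h3 ▸ hCw⟩
    exact .inl (hCo y h1 h2 h3)
  have hle := hmax (F ∆ C) (symmDiff_le_sup.trans (sup_le hFG hCG)) hev'
  refine hle.not_gt (sum_lt_sum (fun y _ => ?_) ⟨v, mem_univ v, ?_⟩)
  · have : F.degree y ≤ (F ∆ C).degree y := by
      by_cases h1 : y = v
      · rw [h1, hv]; exact Nat.zero_le _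
      by_cases h2 : y = u
      · subst h2
        exact degree_le_degree_symmDiff n2 hCu
          fun h => not_adj_of_degree_eq_zero hv _ h.symm
      by_cases h3 : y = w
      · subst h3
        exact degree_le_degree_symmDiff n1 hCw
          fun h => not_adj_of_degree_eq_zero hv _ h.symm
      exact (degree_symmDiff_empty (hCo y h1 h2 h3)).ge
    split_ifs <;> omega
  · rw [degree_symmDiff_of_degree_eq_zero n3 hCv hv, hv]
    simp

/-- Toggling a four-cycle `v u x w` through an isolated vertex `v` of a maximal even subgraph
gives a maximal even subgraph in which `x` is isolated. -/
lemma IsMaxEven.exists_isolated {G F : SimpleGraph V} (hF : G.IsMaxEven F) {v u x w : V}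
    (hv : F.degree v = 0) (hvu : G.Adj v u) (hvw : G.Adj v w) (hxu : G.Adj x u)
    (hxw : G.Adj x w) (huw : u ≠ w) (hxv : x ≠ v) :
    F.neighborFinset x = {u, w} ∧ ∃ F', G.IsMaxEven F' ∧ F'.degree x = 0 := by
  obtain ⟨hFG, hev, hmax⟩ := hF
  obtain ⟨C, hCdef⟩ : ∃ C : SimpleGraph V, ∀ a b, C.Adj a b ↔
      s(a, b) ∈ ({s(v, u), s(v, w), s(x, u), s(x, w)} : Set (Sym2 V)) ∧ a ≠ b :=
    ⟨fromEdgeSet _, fun _ _ => fromEdgeSet_adj _⟩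
  have n1 := hvu.ne
  have n2 := hvw.ne
  have n3 := hxu.ne
  have n4 := hxw.ne
  have hCv : C.neighborFinset v = {u, w} := by ext z; simp [hCdef]; grind
  have hCx : C.neighborFinset x = {u, w} := by ext z; simp [hCdef]; grind
  have hCu : C.neighborFinset u = {v, x} := by ext z; simp [hCdef]; grind
  have hCw : C.neighborFinset w = {v, x} := by ext z; simp [hCdef]; grind
  have hCo : ∀ y, y ≠ v → y ≠ x → y ≠ u → y ≠ w → C.neighborFinset y = ∅ := by
    intro y h1 h2 h3 h4
    ext z; simp [hCdef]; grind
  have hCG : C ≤ G := by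
    intro a b hab
    simp [hCdef] at hab
    grind [G.adj_comm]
  have hev' : (F ∆ C).AllEven := hev.symmDiff fun y => by
    by_cases h1 : y = v
    · exact .inr ⟨u, w, huw, h1 ▸ hCv⟩
    by_cases h2 : y = x
    · exact .inr ⟨u, w, huw, h2 ▸ hCx⟩
    by_cases h3 : y = u
    · exact .inr ⟨v, x, hxv.symm, h3 ▸ hCu⟩
    by_cases h4 : y = w
    · exact .inr ⟨v, x, hxv.symm, h4 ▸ hCw⟩
    exact .inl (hCo y h1 h2 h3 h4)
  have hFG' : F ∆ C ≤ G := symmDiff_le_sup.trans (sup_le hFG hCG)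
  have hle := hmax (F ∆ C) hFG' hev'
  have hmono : ∀ y, y ≠ x → F.degree y ≤ (F ∆ C).degree y := by
    intro y h2
    by_cases h1 : y = v
    · rw [h1, hv]; exact Nat.zero_le _
    by_cases h3 : y = u
    · subst h3
      exact degree_le_degree_symmDiff hxv.symm hCu
        fun h => not_adj_of_degree_eq_zero hv _ h.symm
    by_cases h4 : y = w
    · subst h4
      exact degree_le_degree_symmDiff hxv.symm hCw
        fun h => not_adj_of_degree_eq_zero hv _ h.symm
    exact (degree_symmDiff_empty (hCo y h1 h2 h3 h4)).ge
  have hv' := degree_symmDiff_of_degree_eq_zero huw hCv hv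
  have hx' := degree_symmDiff_pair (F := F) huw hCx
  have hinter : #(F.neighborFinset x ∩ {u, w}) ≤ 2 := by
    rw [← card_pair huw]
    exact card_le_card inter_subset_right
  have hrest : ∑ y ∈ ({v, x} : Finset V)ᶜ, (F.degree y + if F.degree y = 0 then 0 else 1) ≤
      ∑ y ∈ ({v, x} : Finset V)ᶜ,
        ((F ∆ C).degree y + if (F ∆ C).degree y = 0 then 0 else 1) := by
    refine sum_le_sum fun y hy => ?_
    have := hmono y (by simp at hy; tauto)
    split_ifs <;> omega
  have hsplit : ∀ H : SimpleGraph V, H.coverWeight =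
      (H.degree v + if H.degree v = 0 then 0 else 1) +
      (H.degree x + if H.degree x = 0 then 0 else 1) +
      ∑ y ∈ ({v, x} : Finset V)ᶜ, (H.degree y + if H.degree y = 0 then 0 else 1) := by
    intro H
    rw [coverWeight, ← sum_add_sum_compl {v, x}, sum_pair hxv.symm]
  have e1 := hsplit F
  have e2 := hsplit (F ∆ C)
  rw [hv] at e1
  rw [hv'] at e2
  have hzero : (F ∆ C).degree x = 0 := by
    by_contra h
    split_ifs at e1 e2 <;> omega
  have hxdeg : F.degree x = 2 := by
    rw [hzero] at e2
    split_ifs at e1 e2 <;> omega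
  refine ⟨(eq_of_subset_of_card_le ?_ ?_).symm, F ∆ C, ⟨hFG', hev', fun F' h1 h2 => ?_⟩, hzero⟩
  · have : F.neighborFinset x ∩ {u, w} = {u, w} :=
      eq_of_subset_of_card_le inter_subset_right (by rw [card_pair huw]; omega)
    rw [← this]
    exact inter_subset_left
  · rw [card_neighborFinset_eq_degree, card_pair huw, hxdeg]
  · refine (hmax F' h1 h2).trans ?_
    rw [hxdeg] at e1
    rw [hzero] at e2
    split_ifs at e1 e2 <;> omega

lemma IsMaxEven.card_common_le_two {G F : SimpleGraph V} (hF : G.IsMaxEven F) {v x : V}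
    (hv : F.degree v = 0) (hxv : x ≠ v) : #(G.neighborFinset v ∩ G.neighborFinset x) ≤ 2 := by
  by_contra! h
  obtain ⟨a, b, c, ha, hb, hc, hab, hac, hbc⟩ := two_lt_card_iff.1 h
  simp only [mem_inter, mem_neighborFinset] at ha hb hc
  have h1 := (hF.exists_isolated hv ha.1 hb.1 ha.2 hb.2 hab hxv).1
  have h2 := (hF.exists_isolated hv ha.1 hc.1 ha.2 hc.2 hac hxv).1
  have : b ∈ ({a, c} : Finset V) := by rw [← h2, h1]; simp
  grind

lemma sum_neighborFinset_degree_eq (G : SimpleGraph V) (v : V) :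
    ∑ u ∈ G.neighborFinset v, G.degree u =
      ∑ y, #(G.neighborFinset v ∩ G.neighborFinset y) := by
  have h : ∀ y, #(G.neighborFinset v ∩ G.neighborFinset y) =
      ∑ u ∈ G.neighborFinset v, if G.Adj y u then 1 else 0 := by
    intro y
    rw [sum_boole, Nat.cast_id]
    congr 1
    ext
    simp
  simp_rw [h]
  rw [sum_comm]
  refine sum_congr rfl fun u _ => ?_
  rw [sum_boole, Nat.cast_id, ← card_neighborFinset_eq_degree]
  congr 1
  ext
  simp [G.adj_comm]

/-- A graph with many edges in terms of its minimum degree has no isolated vertex in a maximal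
even subgraph. -/
lemma IsMaxEven.degree_ne_zero {G F : SimpleGraph V} (hF : G.IsMaxEven F) {δ : ℕ}
    (hδ2 : 2 ≤ δ) (hδ : ∀ v, δ ≤ G.degree v) (hcard : 5 ≤ Fintype.card V)
    (hsum : (Fintype.card V : ℤ) ^ 2 - 2 * δ * Fintype.card V + Fintype.card V + 2 * δ ^ 2
      - 2 * δ ≤ ∑ v, (G.degree v : ℤ)) (v : V) : F.degree v ≠ 0 := by
  intro hv
  set D := G.neighborFinset v with hD
  set O := (insert v D)ᶜ with hO
  have hvD : v ∉ D := by simp [hD]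
  have hDcard : #D = G.degree v := G.card_neighborFinset_eq_degree v
  have hOcard : #O + (G.degree v + 1) = Fintype.card V := by
    rw [← hDcard, ← card_insert_of_notMem hvD, hO, card_compl_add_card]
  have hind : ∀ y ∈ D, #(D ∩ G.neighborFinset y) = 0 := by
    intro y hy
    rw [card_eq_zero, eq_empty_iff_forall_notMem]
    intro z hz
    simp only [hD, mem_inter, mem_neighborFinset] at hy hz
    exact hF.not_triangle hv hy hz.1 hz.2
  have hcommon : ∀ y ∈ O, #(D ∩ G.neighborFinset y) ≤ 2 := fun y hy =>
    hF.card_common_le_two hv (by simp [hO] at hy; tauto)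
  have hnbr : ∀ y ∈ O, G.neighborFinset y ⊆ (D ∩ G.neighborFinset y) ∪ O.erase y := by
    intro y hy z hz
    have : z ≠ v := by
      rintro rfl
      simp [hO, hD, G.adj_comm] at hy hz
      tauto
    have := G.ne_of_adj ((mem_neighborFinset _ _ _).1 hz)
    simp only [hO, mem_union, mem_inter, mem_erase, mem_compl, mem_insert]
    grind
  have hOdeg : ∀ y ∈ O, G.degree y + 1 ≤ #(D ∩ G.neighborFinset y) + #O := by
    intro y hy
    have h1 := (card_le_card (hnbr y hy)).trans (card_union_le _ _)
    rw [card_erase_of_mem hy, card_neighborFinset_eq_degree] at h1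
    have := card_pos.2 ⟨y, hy⟩
    omega
  have hsplit : ∀ f : V → ℕ, ∑ y, f y = f v + ∑ y ∈ D, f y + ∑ y ∈ O, f y := by
    intro f
    rw [← sum_add_sum_compl (insert v D), sum_insert hvD]
  have htotal : ∑ y, G.degree y =
      2 * G.degree v + ∑ y ∈ O, (#(D ∩ G.neighborFinset y) + G.degree y) := by
    rw [hsplit, sum_neighborFinset_degree_eq, hsplit, sum_eq_zero hind, ← hD, inter_self, hDcard,
      sum_add_distrib]
    ring
  have hterm : ∀ y ∈ O, #(D ∩ G.neighborFinset y) + G.degree y ≤ #O + 3 := by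
    intro y hy
    have := hOdeg y hy
    have := hcommon y hy
    omega
  have hbound := sum_le_card_nsmul O _ _ hterm
  have hdv := hδ v
  rw [← Nat.cast_sum, htotal] at hsum
  rw [smul_eq_mul] at hbound
  have hn : (Fintype.card V : ℤ) = #O + (G.degree v + 1) := by exact_mod_cast hOcard.symm
  zify at hbound hdv hδ2
  push_cast at hsum
  have hδeq : δ = 2 ∧ G.degree v = 2 := by
    obtain ⟨e, he⟩ := Nat.exists_eq_add_of_le (hδ v)
    rw [hn, he] at hsum
    rw [he]
    push_cast at hsum
    have key : ((δ : ℤ) - 1) * (δ - 2) + e * (2 * #O + 1 + e) ≤ 0 := by linarith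
    have h1 : (0 : ℤ) ≤ (δ - 2) * (δ - 2) := mul_self_nonneg _
    have h2 : (0 : ℤ) ≤ e * (2 * #O + e) := by positivity
    have h3 : ((δ : ℤ) - 2) + e ≤ 0 := by linarith
    omega
  obtain ⟨rfl, hdeg⟩ := hδeq
  have heq : ∀ y ∈ O, #(D ∩ G.neighborFinset y) + G.degree y = #O + 3 := by
    by_contra! h
    obtain ⟨y, hy, hne⟩ := h
    have := sum_lt_sum hterm ⟨y, hy, lt_of_le_of_ne (hterm y hy) hne⟩
    rw [sum_const, smul_eq_mul] at this
    zify at this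
    rw [hn, hdeg] at hsum
    push_cast at hsum
    nlinarith
  have hfull : ∀ y ∈ O, D ∩ G.neighborFinset y = D ∧ O.erase y ⊆ G.neighborFinset y := by
    intro y hy
    have h1 := hOdeg y hy
    have h2 := hcommon y hy
    have h3 := heq y hy
    have h4 := card_pos.2 ⟨y, hy⟩
    refine ⟨eq_of_subset_of_card_le inter_subset_left (by omega), ?_⟩
    have h5 := eq_of_subset_of_card_le (hnbr y hy) (by
      refine (card_union_le _ _).trans ?_
      rw [card_erase_of_mem hy, card_neighborFinset_eq_degree]
      omega)
    rw [h5]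
    exact subset_union_right
  obtain ⟨y, z, hy, hz, hyz⟩ := one_lt_card_iff.1 (show 1 < #O by omega)
  obtain ⟨u, w, huw, hDeq⟩ := card_eq_two.1 (hDcard.trans hdeg)
  have hmem : ∀ y ∈ O, ∀ u ∈ D, G.Adj y u := by
    intro y hy u hu
    rw [← (hfull y hy).1] at hu
    simpa using (mem_inter.1 hu).2
  have hu : u ∈ D := by simp [hDeq]
  have hw : w ∈ D := by simp [hDeq]
  obtain ⟨-, F', hF', hy0⟩ := hF.exists_isolated hv (by simpa [hD] using hu)
    (by simpa [hD] using hw) (hmem y hy u hu) (hmem y hy w hw) huw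
    (by simp [hO] at hy; tauto)
  exact hF'.not_triangle hy0 (hmem y hy u hu)
    (by simpa using (hfull y hy).2 (mem_erase.2 ⟨hyz.symm, hz⟩)) (hmem z hz u hu).symm

end EvenSubgraph

end SimpleGraph

lemma sub_le_specRad_joinGraph {s a t p : ℕ} (hs : 0 < s) :
    ((s + a : ℕ) : ℝ) - 1 ≤ specRad (joinGraph s a t p) := by
  classical
  let K : Finset (Fin (s + a + t * p)) := Finset.univ.map (Fin.castAddEmb (t * p))
  have hmem : ∀ x ∈ K, (x : ℕ) < s + a := by
    intro x hx
    simp only [K, Finset.mem_map, Finset.mem_univ, true_and] at hx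
    obtain ⟨y, rfl⟩ := hx
    simp
  have hK : (joinGraph s a t p).IsClique K := by
    intro x hx y hy hxy
    rw [joinGraph, SimpleGraph.fromRel_adj]
    exact ⟨hxy, .inl (.inr (.inr (.inl ⟨hmem x hx, hmem y hy⟩)))⟩
  have hcard : K.card = s + a := by simp [K]
  have := SimpleGraph.IsClique.card_sub_one_le_specRad _ hK
    (Finset.card_pos.1 (by rw [hcard]; omega))
  rwa [hcard] at this

theorem even_factor_of_specRad {V : Type*} [Fintype V] [DecidableEq V]
    (G : SimpleGraph V) [DecidableRel G.Adj] (n δ : ℕ)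
    (hcard : Fintype.card V = n) (hconn : G.Connected) (heven : Even n)
    (hδ : G.minDegree = δ) (hδ2 : 2 ≤ δ)
    (hn1 : 5 * δ - 3 ≤ n) (hn2 : (δ : ℝ) ^ 2 / 3 + δ ≤ (n : ℝ))
    (hspec : specRad (joinGraph δ (n - 2 * δ + 1) (δ - 1) 1) ≤ specRad G) :
    HasEvenFactor G ∨ Nonempty (G ≃g joinGraph δ (n - 2 * δ + 1) (δ - 1) 1) := by
  classical
  left
  have hne : Nonempty V := hconn.nonempty
  have hdeg : ∀ v, δ ≤ G.degree v := fun v => hδ ▸ G.minDegree_le_degree v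
  have hρ : (n : ℝ) - δ ≤ specRad G := by
    refine le_trans ?_ ((sub_le_specRad_joinGraph (by omega)).trans hspec)
    have h : δ + (n - 2 * δ + 1) + δ = n + 1 := by omega
    have h' : ((δ + (n - 2 * δ + 1) : ℕ) : ℝ) + δ = n + 1 := by exact_mod_cast h
    linarith
  have hn : (5 * δ : ℝ) ≤ n + 3 := by exact_mod_cast (by omega : 5 * δ ≤ n + 3)
  have hδ' : (2 : ℝ) ≤ δ := by exact_mod_cast hδ2
  have hsum := SimpleGraph.specRad_mul_sub_le hdeg (by linarith)
  rw [hcard] at hsum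
  have hmul : ((n : ℝ) - δ) * (n - δ - (δ - 1)) ≤ specRad G * (specRad G - (δ - 1)) :=
    mul_le_mul hρ (by linarith) (by linarith) (by linarith)
  have hsum' : (n : ℝ) ^ 2 - 2 * δ * n + n + 2 * δ ^ 2 - 2 * δ ≤ ∑ v, (G.degree v : ℝ) := by
    linarith
  obtain ⟨F, hF⟩ := G.exists_isMaxEven
  refine ⟨F, hF.1, fun v => ?_⟩
  rw [Nat.card_eq_fintype_card, SimpleGraph.card_neighborSet_eq_degree]
  refine ⟨hF.2.1 v, Nat.pos_of_ne_zero (hF.degree_ne_zero hδ2 (fun v => ?_) (by omega) ?_ v)⟩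
  · convert hdeg v
  · rw [hcard]
    have : (n : ℤ) ^ 2 - 2 * δ * n + n + 2 * δ ^ 2 - 2 * δ ≤ ∑ v, (G.degree v : ℤ) := by
      exact_mod_cast hsum'
    convert this
end
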